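/- For every real number k with k ∉ {−3/2, −1/2, 1/2}, the map g*(k) is birational of bidegree (4,4): there exist five homogeneous polynomials G₀,…,G₄ ∈ ℝ[j₀,j₁,j₂,j₃,j₄] of degree 4 and a nonzero homogeneous polynomial μ ∈ ℝ[l₀,l₁,r₀,r₁,h] of degree 15 such that substituting the five components of g*(k) for (j₀,…,j₄) gives G_i(g*(k)) = μ·x_i for i = 0,…,4, where (x₀,x₁,x₂,x₃,x₄) = (l₀,l₁,r₀,r₁,h); moreover there is a nonzero homogeneous ν ∈ ℝ[j₀,…,j₄] of degree 15 such that substituting (G₀,…,G₄) into the components of g*(k) gives ν·j_i in the i-th component. -/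

import Mathlib

open MvPolynomial

noncomputable section

/-- In `ℝ[l₀,l₁,r₀,r₁]` we take `l₀ = X 0`, `l₁ = X 1`, `r₀ = X 2`, `r₁ = X 3`.
`H₀(k; d₀,d₁) = 1 + (k−1)k·(d₀ + (k−2)(k+1)·(6 − 3(k−3)(k−1)k(k+2)·d₁)·d₁)`. -/
def H₀ (k : ℝ) (d₀ d₁ : MvPolynomial (Fin 4) ℝ) : MvPolynomial (Fin 4) ℝ :=
  1 + C ((k - 1) * k) *
    (d₀ + C ((k - 2) * (k + 1)) * (6 - C (3 * (k - 3) * (k - 1) * k * (k + 2)) * d₁) * d₁)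

/-- `H(k)`. -/
def Hp (k : ℝ) : MvPolynomial (Fin 4) ℝ :=
  C (1/2) * (H₀ k (X 0) (X 1) * H₀ (k + 1) (X 2) (X 3)
      + H₀ k (X 2) (X 3) * H₀ (k + 1) (X 0) (X 1))
    - C (36 * (k ^ 2 - 1) * k ^ 2) * (X 1 - X 3) ^ 2

/-- `J₀(k; d₀,d₁)`. -/
def J₀ (k : ℝ) (d₀ d₁ : MvPolynomial (Fin 4) ℝ) : MvPolynomial (Fin 4) ℝ :=
  1 + C (k ^ 2 + k + 3) * d₀ + C (6 * (k ^ 4 + 2 * k ^ 3 + k ^ 2 + 6)) * d₁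
    - C (3 * (k ^ 2 - 9) * (k ^ 2 - 4) * (k ^ 2 - 1) * k * (k + 4)) * d₁ ^ 2

/-- `J₁(k; d₀,d₁)`. -/
def J₁ (k : ℝ) (d₀ d₁ : MvPolynomial (Fin 4) ℝ) : MvPolynomial (Fin 4) ℝ :=
  1 + C (k * (k + 1)) *
    (d₀ + C (3 * (k - 1) * (k + 2)) * (2 - C ((k - 2) * k * (k + 1) * (k + 3)) * d₁) * d₁)

/-- `J(k)`. -/
def Jp (k : ℝ) : MvPolynomial (Fin 4) ℝ :=
  C (1/2) * (J₀ k (X 0) (X 1) * J₁ k (X 2) (X 3) + J₀ k (X 2) (X 3) * J₁ k (X 0) (X 1))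
    + C (108 * (k ^ 2 - 1) * k * (k + 2)) * (X 1 - X 3) ^ 2

/-- `K₀(k) = 1 − (3/2)(k²−1)k(k+2)(l₁+r₁)`. -/
def K₀ (k : ℝ) : MvPolynomial (Fin 4) ℝ :=
  1 - C (3/2 * (k ^ 2 - 1) * k * (k + 2)) * (X 1 + X 3)

/-- `K(k) = (l₀−r₀)·K₀(k)·K₀(−k)`. -/
def Kp (k : ℝ) : MvPolynomial (Fin 4) ℝ := (X 0 - X 2) * K₀ k * K₀ (-k)

/-- `L(k)`. -/
def Lp (k : ℝ) : MvPolynomial (Fin 4) ℝ :=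
  C (3/4 * k ^ 2) * (X 1 - X 3) *
    (C 16 + C (4 * (k ^ 2 - 1)) * (X 0 + X 2 - C (4 * (k ^ 2 - 1)) * (X 1 + X 3))
      - C (3 * (k ^ 2 - 4) * (k ^ 2 - 1) ^ 2) *
        (C 3 * (X 0 * X 3) + C 3 * (X 1 * X 2) + X 0 * X 1 + X 2 * X 3
          + C (16 * (k ^ 2 - 6)) * (X 1 * X 3)))

/-- The (inhomogeneous) two-sided Krall–Jacobi map of rank 4:
`g(k) = (H(k) : K(k)+L(k) : J(k) : K(k+1)+L(k+1) : H(k+1))`. -/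
def g (k : ℝ) : Fin 5 → MvPolynomial (Fin 4) ℝ :=
  ![Hp k, Kp k + Lp k, Jp k, Kp (k + 1) + Lp (k + 1), Hp (k + 1)]

/-- Homogenization to degree `n` with the extra variable `h = X 4`:
each monomial `m` of `p` is multiplied by `h^(n − deg m)`. -/
def homog (n : ℕ) (p : MvPolynomial (Fin 4) ℝ) : MvPolynomial (Fin 5) ℝ :=
  p.support.sum fun m =>
    monomial (Finsupp.mapDomain Fin.castSucc m
        + Finsupp.single (4 : Fin 5) (n - m.sum fun _ e => e))
      (coeff m p)

/-- The homogenized map `g*(k)`: in `ℝ[l₀,l₁,r₀,r₁,h]` we take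
`l₀ = X 0`, `l₁ = X 1`, `r₀ = X 2`, `r₁ = X 3`, `h = X 4`. -/
def gstar (k : ℝ) : Fin 5 → MvPolynomial (Fin 5) ℝ := fun i => homog 4 (g k i)

/-- The Jacobian determinant of a 5-tuple of polynomials in five variables. -/
def jacDet (p : Fin 5 → MvPolynomial (Fin 5) ℝ) : MvPolynomial (Fin 5) ℝ :=
  Matrix.det (Matrix.of fun i j => pderiv j (p i))

/-- The left-right involution `LR` on `ℝ[l₀,l₁,r₀,r₁,h]`, swapping
`l₀ ↔ r₀`, `l₁ ↔ r₁` and fixing `h`. -/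
def LR : MvPolynomial (Fin 5) ℝ →ₐ[ℝ] MvPolynomial (Fin 5) ℝ :=
  rename ![2, 3, 0, 1, 4]


end



/-! ### Generic formulas over a commutative ring

With `t = k(k+1)`, the map `g*(k)` is, up to an invertible linear change of coordinates, the map
`x ↦ (h T, Z, Z', l₁ T, r₁ T')`, which can be inverted by hand. -/

namespace Krall

section generic
variable {R : Type*} [CommRing R]

/-- The quadratic form `φ`. -/
def phi (t x y h : R) : R := x * h + 6 * (t - 2) * y * h - 3 * (t - 2) * t * (t - 6) * y ^ 2

/-- `u = h² + t φ`. -/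
def uu (t x y h : R) : R := h ^ 2 + t * phi t x y h

/-- `e = h - 3 t (t-2) y`. -/
def ee (t y h : R) : R := h - 3 * t * (t - 2) * y

/-- The cubic `T`. -/
def TT (t _l0 l1 r0 r1 h : R) : R :=
  ee t l1 h * uu t r0 r1 h + 6 * t * (r1 - l1) * ee t r1 h * h

/-- The quartic `Z`. -/
def ZZ (t l0 l1 r0 r1 h : R) : R :=
  (phi t l0 l1 h + 3 * (t - 2) * l1 * h) * uu t r0 r1 h + 36 * t * (r1 - l1) ^ 2 * h ^ 2
    - 6 * (r1 - l1) * ee t r1 h * h ^ 2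

/-- The linear map from `(P, Z, Z', Q, Q')` to `j`; `hf` stands for `1/2`. -/
def lin (k hf P Z Z' Q Q' : R) : Fin 5 → R :=
  ![P + k ^ 2 * Z - k * Z' - 3 * k * (k - 1) * (k - 2) * (Q + Q'),
    Z - Z' + 3 * (k - 1) * (k - 2) * (Q - Q'),
    P + (k * (k + 1) + 3 * hf) * Z + 3 * hf * Z' + (45 - 15 * hf * (k * (k + 1))) * (Q + Q'),
    Z - Z' + 3 * (k + 2) * (k + 3) * (Q - Q'),
    P + (k + 1) ^ 2 * Z + (k + 1) * Z' + 3 * (k + 1) * (k + 2) * (k + 3) * (Q + Q')]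

/-- The forward map. -/
def fwd (k hf : R) (x : Fin 5 → R) : Fin 5 → R :=
  lin k hf (x 4 * TT (k * (k + 1)) (x 0) (x 1) (x 2) (x 3) (x 4))
    (ZZ (k * (k + 1)) (x 0) (x 1) (x 2) (x 3) (x 4))
    (ZZ (k * (k + 1)) (x 2) (x 3) (x 0) (x 1) (x 4))
    (x 1 * TT (k * (k + 1)) (x 0) (x 1) (x 2) (x 3) (x 4))
    (x 3 * TT (k * (k + 1)) (x 2) (x 3) (x 0) (x 1) (x 4))

/-- The bracket in the inverse map. -/
def BB (t P P' Z Q Q' : R) : R :=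
  Z * P - 3 * (t - 2) * (P + t * Z) * Q + 6 * (Q' * P - Q * P') - 6 * (t - 2) * Q * P
    + 3 * (t - 2) * t * (t - 6) * Q ^ 2

/-- The inverse map in the coordinates `(P, P', Z, Z', Q, Q')`. -/
def bwd (t P P' Z Z' Q Q' : R) : Fin 5 → R :=
  ![P' ^ 2 * BB t P P' Z Q Q', Q * P * P' ^ 2, P ^ 2 * BB t P' P Z' Q' Q, Q' * P' * P ^ 2,
    P ^ 2 * P' ^ 2]

/-- The cubic `N`. -/
def NN (t P P' Z Q Q' : R) : R :=
  (P + t * Z) * ee t Q P * ee t Q' P' + 6 * t * (Q' * P - Q * P') * (ee t Q' P' - ee t Q P)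

/-- `Q + Q'` from `j`; here `a, b, c` stand for the inverses of `2k-1, 2k+3, 2k+1`
and `i12` for `1/12`. -/
def iX (a b c i12 : R) (j : Fin 5 → R) : R :=
  i12 * a * (c * (j 4 - j 0) - 2 * b * (j 2 - j 0))

/-- `Q - Q'` from `j`. -/
def iD (c i12 : R) (j : Fin 5 → R) : R := i12 * c * (j 3 - j 1)

/-- `Z + Z'` from `j`. -/
def iS (k a b c i12 : R) (j : Fin 5 → R) : R :=
  c * (j 4 - j 0) - 3 * (k * (k + 1) + 6) * iX a b c i12 j

/-- `Z - Z'` from `j`. -/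
def iY (k c i12 : R) (j : Fin 5 → R) : R := j 1 - 3 * (k - 1) * (k - 2) * iD c i12 j

/-- `Z` (for `s = 1`) and `Z'` (for `s = -1`) from `j`. -/
def iZ (k hf a b c i12 s : R) (j : Fin 5 → R) : R :=
  hf * (iS k a b c i12 j + s * iY k c i12 j)

/-- `Q` (for `s = 1`) and `Q'` (for `s = -1`) from `j`. -/
def iQ (hf a b c i12 s : R) (j : Fin 5 → R) : R := hf * (iX a b c i12 j + s * iD c i12 j)

/-- `P` (for `s = 1`) and `P'` (for `s = -1`) from `j`. -/
def iP (k hf a b c i12 s : R) (j : Fin 5 → R) : R :=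
  j 0 - hf * (k * (k - 1)) * iS k a b c i12 j + 3 * k * (k - 1) * (k - 2) * iX a b c i12 j
    - s * (hf * (k * (k + 1))) * iY k c i12 j

/-- The inverse map. -/
def inv (k hf a b c i12 : R) (j : Fin 5 → R) : Fin 5 → R :=
  bwd (k * (k + 1)) (iP k hf a b c i12 1 j) (iP k hf a b c i12 (-1) j)
    (iZ k hf a b c i12 1 j) (iZ k hf a b c i12 (-1) j)
    (iQ hf a b c i12 1 j) (iQ hf a b c i12 (-1) j)

/-- The factor `μ`. -/
def mu (k : R) (x : Fin 5 → R) : R :=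
  x 4 ^ 3 * TT (k * (k + 1)) (x 0) (x 1) (x 2) (x 3) (x 4) ^ 2
    * TT (k * (k + 1)) (x 2) (x 3) (x 0) (x 1) (x 4) ^ 2

/-- The factor `ν`. -/
def nu (k hf a b c i12 : R) (j : Fin 5 → R) : R :=
  iP k hf a b c i12 1 j ^ 6 * iP k hf a b c i12 (-1) j ^ 6
    * NN (k * (k + 1)) (iP k hf a b c i12 1 j) (iP k hf a b c i12 (-1) j)
    (iZ k hf a b c i12 1 j) (iQ hf a b c i12 1 j) (iQ hf a b c i12 (-1) j)

theorem ZZ_swap (t l0 l1 r0 r1 h : R) :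
    h * TT t l0 l1 r0 r1 h + t * ZZ t l0 l1 r0 r1 h
      = h * TT t r0 r1 l0 l1 h + t * ZZ t r0 r1 l0 l1 h := by
  simp only [TT, ZZ, uu, ee]; ring

theorem BB_fwd (t l0 l1 r0 r1 h : R) :
    BB t (h * TT t l0 l1 r0 r1 h) (h * TT t r0 r1 l0 l1 h) (ZZ t l0 l1 r0 r1 h)
      (l1 * TT t l0 l1 r0 r1 h) (r1 * TT t r0 r1 l0 l1 h)
      = TT t l0 l1 r0 r1 h ^ 2 * (l0 * h) := by
  have h1 : ZZ t l0 l1 r0 r1 h * h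
      - 3 * (t - 2) * (h * TT t l0 l1 r0 r1 h + t * ZZ t l0 l1 r0 r1 h) * l1
      + 6 * h * (r1 - l1) * TT t r0 r1 l0 l1 h
      = TT t l0 l1 r0 r1 h * phi t l0 l1 h := by
    simp only [TT, ZZ, uu, ee]; ring
  have h2 : l0 * h = phi t l0 l1 h - 6 * (t - 2) * l1 * h
      + 3 * (t - 2) * t * (t - 6) * l1 ^ 2 := by
    simp only [phi]; ring
  rw [h2]
  simp only [BB]
  linear_combination (TT t l0 l1 r0 r1 h) * h1

theorem bwd_fwd (t l0 l1 r0 r1 h : R) :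
    bwd t (h * TT t l0 l1 r0 r1 h) (h * TT t r0 r1 l0 l1 h) (ZZ t l0 l1 r0 r1 h)
      (ZZ t r0 r1 l0 l1 h) (l1 * TT t l0 l1 r0 r1 h) (r1 * TT t r0 r1 l0 l1 h)
      = fun i => (h ^ 3 * TT t l0 l1 r0 r1 h ^ 2 * TT t r0 r1 l0 l1 h ^ 2)
        * (![l0, l1, r0, r1, h] : Fin 5 → R) i := by
  funext i
  fin_cases i
  · simp [bwd, BB_fwd]; ring
  · simp [bwd]; ring
  · simp [bwd, BB_fwd]; ring
  · simp [bwd]; ring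
  · simp [bwd]; ring

theorem phi_bwd (t P P' Z Q Q' : R) :
    phi t (P' ^ 2 * BB t P P' Z Q Q') (Q * P * P' ^ 2) (P ^ 2 * P' ^ 2)
      = P ^ 2 * P' ^ 4 * (Z * P - 3 * (t - 2) * (P + t * Z) * Q + 6 * (Q' * P - Q * P')) := by
  simp only [phi, BB]; ring

theorem uu_bwd (t P P' Z Q Q' : R) :
    uu t (P' ^ 2 * BB t P P' Z Q Q') (Q * P * P' ^ 2) (P ^ 2 * P' ^ 2)
      = P ^ 2 * P' ^ 4 * ((P + t * Z) * ee t Q P + 6 * t * (Q' * P - Q * P')) := by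
  simp only [uu, phi_bwd, ee]; ring

theorem ee_bwd (t P P' Q : R) :
    ee t (Q * P * P' ^ 2) (P ^ 2 * P' ^ 2) = P * P' ^ 2 * ee t Q P := by
  simp only [ee]; ring

theorem TT_bwd (t P P' Z Z' Q Q' : R) (hP : P + t * Z = P' + t * Z') :
    TT t (P' ^ 2 * BB t P P' Z Q Q') (Q * P * P' ^ 2) (P ^ 2 * BB t P' P Z' Q' Q)
      (Q' * P' * P ^ 2) (P ^ 2 * P' ^ 2) = P ^ 5 * P' ^ 4 * NN t P P' Z Q Q' := by
  have h1 := uu_bwd t P' P Z' Q' Q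
  have h2 := ee_bwd t P' P Q'
  rw [mul_comm (P' ^ 2) (P ^ 2)] at h1 h2
  simp only [TT, h1, h2, ee_bwd, NN, ← hP]
  generalize ee t Q P = E
  generalize ee t Q' P' = E'
  ring

theorem ZZ_bwd (t P P' Z Z' Q Q' : R) (hP : P + t * Z = P' + t * Z') :
    ZZ t (P' ^ 2 * BB t P P' Z Q Q') (Q * P * P' ^ 2) (P ^ 2 * BB t P' P Z' Q' Q)
      (Q' * P' * P ^ 2) (P ^ 2 * P' ^ 2) = P ^ 6 * P' ^ 6 * NN t P P' Z Q Q' * Z := by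
  have h1 := uu_bwd t P' P Z' Q' Q
  have h2 := ee_bwd t P' P Q'
  rw [mul_comm (P' ^ 2) (P ^ 2)] at h1 h2
  have h3 : Z * P - 3 * (t - 2) * (P + t * Z) * Q + 3 * (t - 2) * Q * P = Z * ee t Q P := by
    simp only [ee]; ring
  simp only [ZZ, h1, h2, phi_bwd, NN, ← hP]
  generalize ee t Q P = E at *
  generalize ee t Q' P' = E'
  linear_combination (P ^ 6 * P' ^ 6 * ((P + t * Z) * E' - 6 * t * (Q' * P - Q * P'))) * h3

theorem NN_swap (t P P' Z Z' Q Q' : R) (hP : P + t * Z = P' + t * Z') :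
    NN t P' P Z' Q' Q = NN t P P' Z Q Q' := by
  simp only [NN, ← hP]; ring

theorem fwd_bwd (k hf P P' Z Z' Q Q' : R)
    (hP : P + k * (k + 1) * Z = P' + k * (k + 1) * Z') :
    fwd k hf (bwd (k * (k + 1)) P P' Z Z' Q Q')
      = fun i => (P ^ 6 * P' ^ 6 * NN (k * (k + 1)) P P' Z Q Q') * lin k hf P Z Z' Q Q' i := by
  generalize ht : k * (k + 1) = t at *
  have t1 := TT_bwd t P P' Z Z' Q Q' hP
  have z1 := ZZ_bwd t P P' Z Z' Q Q' hP
  have t2 := TT_bwd t P' P Z' Z Q' Q hP.symm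
  have z2 := ZZ_bwd t P' P Z' Z Q' Q hP.symm
  rw [mul_comm (P' ^ 2) (P ^ 2), NN_swap t P P' Z Z' Q Q' hP] at t2 z2
  have e : fwd k hf (bwd t P P' Z Z' Q Q')
      = lin k hf (P ^ 6 * P' ^ 6 * NN t P P' Z Q Q' * P) (P ^ 6 * P' ^ 6 * NN t P P' Z Q Q' * Z)
        (P ^ 6 * P' ^ 6 * NN t P P' Z Q Q' * Z') (P ^ 6 * P' ^ 6 * NN t P P' Z Q Q' * Q)
        (P ^ 6 * P' ^ 6 * NN t P P' Z Q Q' * Q') := by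
    simp only [fwd, bwd, ht, Matrix.cons_val]
    rw [t1, z1, t2, z2]
    congr 1 <;> ring
  rw [e]
  generalize P ^ 6 * P' ^ 6 * NN t P P' Z Q Q' = n
  funext i
  fin_cases i <;> simp [lin] <;> ring

end generic

/-! ### Inverting the linear part over the reals -/

theorem inv_lin (k a b c P Z Z' Q Q' : ℝ) (ha : a * (2 * k - 1) = 1) (hb : b * (2 * k + 3) = 1)
    (hc : c * (2 * k + 1) = 1) :
    inv k (1/2) a b c (1/12) (lin k (1/2) P Z Z' Q Q')
      = bwd (k * (k + 1)) P (P + k * (k + 1) * (Z - Z')) Z Z' Q Q' := by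
  set j := lin k (1/2) P Z Z' Q Q' with hj
  have hX : iX a b c (1/12) j = Q + Q' := by
    have h1 : c * (j 4 - j 0) = (Z + Z') + 3 * (k * (k + 1) + 6) * (Q + Q') := by
      simp only [hj, lin, Matrix.cons_val]
      linear_combination ((Z + Z') + 3 * (k * (k + 1) + 6) * (Q + Q')) * hc
    have h2 : b * (j 2 - j 0) = (Z + Z') / 2 + 3 / 2 * (k ^ 2 - 7 * k + 10) * (Q + Q') := by
      simp only [hj, lin, Matrix.cons_val]
      linear_combination ((Z + Z') / 2 + 3 / 2 * (k ^ 2 - 7 * k + 10) * (Q + Q')) * hb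
    simp only [iX]
    linear_combination (1/12 * a) * h1 - (1/6 * a) * h2 + (Q + Q') * ha
  have hD : iD c (1/12) j = Q - Q' := by
    simp only [iD, hj, lin, Matrix.cons_val]
    linear_combination (Q - Q') * hc
  have hY : iY k c (1/12) j = Z - Z' := by
    simp only [iY, hD]
    simp only [hj, lin, Matrix.cons_val]
    ring
  have hS : iS k a b c (1/12) j = Z + Z' := by
    simp only [iS, hX]
    simp only [hj, lin, Matrix.cons_val]
    linear_combination ((Z + Z') + 3 * (k * (k + 1) + 6) * (Q + Q')) * hc
  have hQ1 : iQ (1/2) a b c (1/12) 1 j = Q := by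
    simp only [iQ, hX, hD]; ring
  have hQ2 : iQ (1/2) a b c (1/12) (-1) j = Q' := by
    simp only [iQ, hX, hD]; ring
  have hZ1 : iZ k (1/2) a b c (1/12) 1 j = Z := by
    simp only [iZ, hS, hY]; ring
  have hZ2 : iZ k (1/2) a b c (1/12) (-1) j = Z' := by
    simp only [iZ, hS, hY]; ring
  have hj0 : j 0 = P + k ^ 2 * Z - k * Z' - 3 * k * (k - 1) * (k - 2) * (Q + Q') := by
    simp only [hj, lin, Matrix.cons_val]
  have hP1 : iP k (1/2) a b c (1/12) 1 j = P := by
    simp only [iP, hS, hY, hX, hj0]; ring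
  have hP2 : iP k (1/2) a b c (1/12) (-1) j = P + k * (k + 1) * (Z - Z') := by
    simp only [iP, hS, hY, hX, hj0]; ring
  simp only [inv, hQ1, hQ2, hZ1, hZ2, hP1, hP2]

theorem lin_inv (k a b c : ℝ) (j : Fin 5 → ℝ) (ha : a * (2 * k - 1) = 1)
    (hb : b * (2 * k + 3) = 1) (hc : c * (2 * k + 1) = 1) :
    lin k (1/2) (iP k (1/2) a b c (1/12) 1 j)
      (iZ k (1/2) a b c (1/12) 1 j) (iZ k (1/2) a b c (1/12) (-1) j)
      (iQ (1/2) a b c (1/12) 1 j) (iQ (1/2) a b c (1/12) (-1) j) = j := by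
  have hX : 12 * (2 * k - 1) * iX a b c (1/12) j
      = c * (j 4 - j 0) - 2 * b * (j 2 - j 0) := by
    simp only [iX]
    linear_combination (c * (j 4 - j 0) - 2 * b * (j 2 - j 0)) * ha
  have hD : 12 * (2 * k + 1) * iD c (1/12) j = j 3 - j 1 := by
    simp only [iD]
    linear_combination (j 3 - j 1) * hc
  have hY : iY k c (1/12) j = j 1 - 3 * (k - 1) * (k - 2) * iD c (1/12) j := rfl
  have hS : iS k a b c (1/12) j
    = c * (j 4 - j 0) - 3 * (k * (k + 1) + 6) * iX a b c (1/12) j := rfl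
  simp only [iP, iZ, iQ, hY, hS]
  generalize iX a b c (1/12) j = X at *
  generalize iD c (1/12) j = D at *
  funext i
  fin_cases i
  · simp [lin]; ring
  · simp [lin]; ring
  · simp [lin]
    linear_combination (-(2 * k + 3) / 2) * hX + (j 2 - j 0) * hb
  · simp [lin]
    linear_combination hD
  · simp [lin]
    linear_combination (j 4 - j 0) * hc

theorem inv_fwd (k a b c : ℝ) (x : Fin 5 → ℝ) (ha : a * (2 * k - 1) = 1)
    (hb : b * (2 * k + 3) = 1) (hc : c * (2 * k + 1) = 1) (i : Fin 5) :
    inv k (1/2) a b c (1/12) (fwd k (1/2) x) i = mu k x * x i := by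
  have h := ZZ_swap (k * (k + 1)) (x 0) (x 1) (x 2) (x 3) (x 4)
  have h' : x 4 * TT (k * (k + 1)) (x 0) (x 1) (x 2) (x 3) (x 4)
      + k * (k + 1) * (ZZ (k * (k + 1)) (x 0) (x 1) (x 2) (x 3) (x 4)
        - ZZ (k * (k + 1)) (x 2) (x 3) (x 0) (x 1) (x 4))
      = x 4 * TT (k * (k + 1)) (x 2) (x 3) (x 0) (x 1) (x 4) := by
    linear_combination h
  rw [fwd, inv_lin k a b c _ _ _ _ _ ha hb hc, h', bwd_fwd]
  fin_cases i <;> simp [mu]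

theorem fwd_inv (k a b c : ℝ) (j : Fin 5 → ℝ) (ha : a * (2 * k - 1) = 1)
    (hb : b * (2 * k + 3) = 1) (hc : c * (2 * k + 1) = 1) (i : Fin 5) :
    fwd k (1/2) (inv k (1/2) a b c (1/12) j) i = nu k (1/2) a b c (1/12) j * j i := by
  have hP : iP k (1/2) a b c (1/12) 1 j + k * (k + 1) * iZ k (1/2) a b c (1/12) 1 j
      = iP k (1/2) a b c (1/12) (-1) j + k * (k + 1) * iZ k (1/2) a b c (1/12) (-1) j := by
    simp only [iP, iZ]; ring
  rw [inv, fwd_bwd k (1/2) _ _ _ _ _ _ hP, lin_inv k a b c j ha hb hc]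
  rfl

/-! ### Homogenization -/

/-- `homog n` as an additive map. -/
noncomputable def homogHom (n : ℕ) : MvPolynomial (Fin 4) ℝ →+ MvPolynomial (Fin 5) ℝ where
  toFun := homog n
  map_zero' := by simp [homog]
  map_add' p q := by
    classical
    have key : ∀ (r : MvPolynomial (Fin 4) ℝ) (S : Finset (Fin 4 →₀ ℕ)), r.support ⊆ S →
        homog n r = ∑ m ∈ S, monomial (Finsupp.mapDomain Fin.castSucc m
          + Finsupp.single (4 : Fin 5) (n - m.sum fun _ e => e)) (coeff m r) := by
      intro r S hS
      refine Finset.sum_subset hS ?_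
      intro m _ hm
      rw [notMem_support_iff.mp hm, map_zero]
    rw [key (p + q) (p.support ∪ q.support) support_add,
      key p (p.support ∪ q.support) Finset.subset_union_left,
      key q (p.support ∪ q.support) Finset.subset_union_right, ← Finset.sum_add_distrib]
    refine Finset.sum_congr rfl fun m _ => ?_
    rw [coeff_add, map_add]

theorem homog_monomial (n : ℕ) (m : Fin 4 →₀ ℕ) (c : ℝ) :
    homogHom n (monomial m c) = monomial (Finsupp.mapDomain Fin.castSucc m
        + Finsupp.single (4 : Fin 5) (n - m.sum fun _ e => e)) c := by
  classical
  change homog n (monomial m c) = _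
  by_cases hc : c = 0
  · simp [homog, hc]
  · simp [homog, support_monomial, hc]

theorem homog_dehom (q : MvPolynomial (Fin 5) ℝ) (hq : q.IsHomogeneous 4) :
    homog 4 (aeval (![X 0, X 1, X 2, X 3, 1] : Fin 5 → MvPolynomial (Fin 4) ℝ) q) = q := by
  change homogHom 4 _ = q
  conv_lhs => rw [q.as_sum]
  conv_rhs => rw [q.as_sum]
  rw [map_sum, map_sum]
  refine Finset.sum_congr rfl fun m hm => ?_
  have hdeg : m.degree = 4 := by
    have := hq (mem_support_iff.mp hm)
    rwa [Finsupp.degree_eq_weight_one]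
  set m' : Fin 4 →₀ ℕ := Finsupp.equivFunOnFinite.symm (fun i => m i.castSucc) with hm'
  have h1 : aeval (![X 0, X 1, X 2, X 3, 1] : Fin 5 → MvPolynomial (Fin 4) ℝ)
      (monomial m (coeff m q)) = monomial m' (coeff m q) := by
    rw [aeval_monomial, monomial_eq, Finsupp.prod_fintype _ _ (by simp),
      Finsupp.prod_fintype _ _ (by simp), Fin.prod_univ_five, Fin.prod_univ_four]
    simp [hm']
  rw [h1, homog_monomial]
  refine congrArg (fun e => monomial e (coeff m q)) ?_
  rw [Finsupp.sum_fintype _ _ (by simp)]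
  rw [Finsupp.degree_eq_sum, Fin.sum_univ_castSucc] at hdeg
  ext i
  refine Fin.lastCases ?_ (fun i => ?_) i
  · have h0 : (Finsupp.mapDomain Fin.castSucc m') (Fin.last 4) = 0 := by
      refine Finsupp.mapDomain_of_notMem_range _ _ ?_
      rintro ⟨y, hy⟩
      exact (Fin.castSucc_lt_last y).ne hy
    rw [Finsupp.add_apply, h0]
    have : (4 : Fin 5) = Fin.last 4 := rfl
    rw [this, Finsupp.single_eq_same]
    simp only [hm', Finsupp.coe_equivFunOnFinite_symm]
    omega
  · rw [Finsupp.add_apply, Finsupp.mapDomain_apply (Fin.castSucc_injective 4),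
      Finsupp.single_eq_of_ne (by intro h; exact (Fin.castSucc_lt_last i).ne h)]
    simp [hm']

/-! ### Homogeneity -/

section homogeneity

theorem hnum (n : ℕ) [n.AtLeastTwo] :
    (OfNat.ofNat n : MvPolynomial (Fin 5) ℝ).IsHomogeneous 0 := by
  rw [← map_ofNat (C : ℝ →+* MvPolynomial (Fin 5) ℝ) n]
  exact isHomogeneous_C _ _

theorem hone : (1 : MvPolynomial (Fin 5) ℝ).IsHomogeneous 0 := isHomogeneous_one _ _

variable {t x y h l0 l1 r0 r1 : MvPolynomial (Fin 5) ℝ}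

theorem phi_hom {n : ℕ} (ht : t.IsHomogeneous 0) (hx : x.IsHomogeneous n) (hy : y.IsHomogeneous n)
    (hh : h.IsHomogeneous n) : (phi t x y h).IsHomogeneous (n + n) := by
  have h1 : (6 * (t - 2) * y * h).IsHomogeneous (0 + 0 + n + n) :=
    (((hnum 6).mul (ht.sub (hnum 2))).mul hy).mul hh
  have h2 : (3 * (t - 2) * t * (t - 6) * y ^ 2).IsHomogeneous (0 + 0 + 0 + 0 + n * 2) :=
    ((((hnum 3).mul (ht.sub (hnum 2))).mul ht).mul (ht.sub (hnum 6))).mul (hy.pow 2)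
  have e1 : 0 + 0 + n + n = n + n := by omega
  have e2 : 0 + 0 + 0 + 0 + n * 2 = n + n := by omega
  rw [e1] at h1
  rw [e2] at h2
  exact ((hx.mul hh).add h1).sub h2

theorem uu_hom (ht : t.IsHomogeneous 0) (hx : x.IsHomogeneous 1) (hy : y.IsHomogeneous 1)
    (hh : h.IsHomogeneous 1) : (uu t x y h).IsHomogeneous 2 :=
  IsHomogeneous.add (hh.pow 2) (ht.mul (phi_hom ht hx hy hh))

theorem ee_hom (ht : t.IsHomogeneous 0) (hy : y.IsHomogeneous 1)
    (hh : h.IsHomogeneous 1) : (ee t y h).IsHomogeneous 1 :=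
  IsHomogeneous.sub hh ((((hnum 3).mul ht).mul (ht.sub (hnum 2))).mul hy)

theorem TT_hom (ht : t.IsHomogeneous 0) (hl1 : l1.IsHomogeneous 1)
    (hr0 : r0.IsHomogeneous 1) (hr1 : r1.IsHomogeneous 1) (hh : h.IsHomogeneous 1) :
    (TT t l0 l1 r0 r1 h).IsHomogeneous 3 :=
  IsHomogeneous.add ((ee_hom ht hl1 hh).mul (uu_hom ht hr0 hr1 hh))
    (((((hnum 6).mul ht).mul (hr1.sub hl1)).mul (ee_hom ht hr1 hh)).mul hh)

theorem ZZ_hom (ht : t.IsHomogeneous 0) (hl0 : l0.IsHomogeneous 1) (hl1 : l1.IsHomogeneous 1)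
    (hr0 : r0.IsHomogeneous 1) (hr1 : r1.IsHomogeneous 1) (hh : h.IsHomogeneous 1) :
    (ZZ t l0 l1 r0 r1 h).IsHomogeneous 4 := by
  have h1 : (phi t l0 l1 h + 3 * (t - 2) * l1 * h).IsHomogeneous 2 :=
    IsHomogeneous.add (phi_hom ht hl0 hl1 hh)
      ((((hnum 3).mul (ht.sub (hnum 2))).mul hl1).mul hh)
  have h2 : (36 * t * (r1 - l1) ^ 2 * h ^ 2).IsHomogeneous 4 :=
    (((hnum 36).mul ht).mul ((hr1.sub hl1).pow 2)).mul (hh.pow 2)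
  have h3 : (6 * (r1 - l1) * ee t r1 h * h ^ 2).IsHomogeneous 4 :=
    (((hnum 6).mul (hr1.sub hl1)).mul (ee_hom ht hr1 hh)).mul (hh.pow 2)
  exact IsHomogeneous.sub (IsHomogeneous.add (h1.mul (uu_hom ht hr0 hr1 hh)) h2) h3

theorem zmul {n : ℕ} {p q : MvPolynomial (Fin 5) ℝ} (hp : p.IsHomogeneous 0)
    (hq : q.IsHomogeneous n) : (p * q).IsHomogeneous n := by
  have := hp.mul hq
  rwa [zero_add] at this

theorem zmul0 {p q : MvPolynomial (Fin 5) ℝ} (hp : p.IsHomogeneous 0)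
    (hq : q.IsHomogeneous 0) : (p * q).IsHomogeneous 0 := zmul hp hq

variable {k hf a b c i12 s : MvPolynomial (Fin 5) ℝ}

theorem fwd_hom (hk : k.IsHomogeneous 0) (hhf : hf.IsHomogeneous 0) (i : Fin 5) :
    (fwd k hf (X : Fin 5 → MvPolynomial (Fin 5) ℝ) i).IsHomogeneous 4 := by
  have ht : (k * (k + 1)).IsHomogeneous 0 := zmul0 hk (hk.add hone)
  have hX : ∀ i, (X i : MvPolynomial (Fin 5) ℝ).IsHomogeneous 1 := fun i => isHomogeneous_X _ i
  have hP : (X 4 * TT (k * (k + 1)) (X 0) (X 1) (X 2) (X 3) (X 4)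
    : MvPolynomial (Fin 5) ℝ).IsHomogeneous 4 :=
    (hX 4).mul (TT_hom ht (hX 1) (hX 2) (hX 3) (hX 4))
  have hQ : (X 1 * TT (k * (k + 1)) (X 0) (X 1) (X 2) (X 3) (X 4)
    : MvPolynomial (Fin 5) ℝ).IsHomogeneous 4 :=
    (hX 1).mul (TT_hom ht (hX 1) (hX 2) (hX 3) (hX 4))
  have hQ' : (X 3 * TT (k * (k + 1)) (X 2) (X 3) (X 0) (X 1) (X 4)
    : MvPolynomial (Fin 5) ℝ).IsHomogeneous 4 :=
    (hX 3).mul (TT_hom ht (hX 3) (hX 0) (hX 1) (hX 4))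
  have hZ := ZZ_hom ht (hX 0) (hX 1) (hX 2) (hX 3) (hX 4)
  have hZ' := ZZ_hom ht (hX 2) (hX 3) (hX 0) (hX 1) (hX 4)
  have k1 := hk.add hone
  have km1 := hk.sub hone
  have km2 := hk.sub (hnum 2)
  have k2 := hk.add (hnum 2)
  have k3 := hk.add (hnum 3)
  have hh3 := zmul0 (hnum 3) hhf
  unfold fwd
  fin_cases i
  · exact ((hP.add (zmul (hk.pow 2) hZ)).sub (zmul hk hZ')).sub
      (zmul (zmul0 (zmul0 (zmul0 (hnum 3) hk) km1) km2) (hQ.add hQ'))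
  · exact (hZ.sub hZ').add (zmul (zmul0 (zmul0 (hnum 3) km1) km2) (hQ.sub hQ'))
  · exact ((hP.add (zmul (ht.add hh3) hZ)).add (zmul hh3 hZ')).add
      (zmul ((hnum 45).sub (zmul0 (zmul0 (hnum 15) hhf) ht)) (hQ.add hQ'))
  · exact (hZ.sub hZ').add (zmul (zmul0 (zmul0 (hnum 3) k2) k3) (hQ.sub hQ'))
  · exact ((hP.add (zmul (k1.pow 2) hZ)).add (zmul k1 hZ')).add
      (zmul (zmul0 (zmul0 (zmul0 (hnum 3) k1) k2) k3) (hQ.add hQ'))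

theorem mu_hom (hk : k.IsHomogeneous 0) :
    (mu k (X : Fin 5 → MvPolynomial (Fin 5) ℝ)).IsHomogeneous 15 := by
  have ht : (k * (k + 1)).IsHomogeneous 0 := zmul0 hk (hk.add hone)
  have hX : ∀ i, (X i : MvPolynomial (Fin 5) ℝ).IsHomogeneous 1 := fun i => isHomogeneous_X _ i
  exact (((hX 4).pow 3).mul ((TT_hom ht (hX 1) (hX 2) (hX 3) (hX 4)).pow 2)).mul
    ((TT_hom ht (hX 3) (hX 0) (hX 1) (hX 4)).pow 2)

theorem BB_hom {P P' Z Q Q' : MvPolynomial (Fin 5) ℝ} (ht : t.IsHomogeneous 0)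
    (hP : P.IsHomogeneous 1) (hP' : P'.IsHomogeneous 1) (hZ : Z.IsHomogeneous 1)
    (hQ : Q.IsHomogeneous 1) (hQ' : Q'.IsHomogeneous 1) :
    (BB t P P' Z Q Q').IsHomogeneous 2 := by
  have t2 := ht.sub (hnum 2)
  have h1 : (3 * (t - 2) * (P + t * Z) * Q).IsHomogeneous 2 :=
    (zmul (zmul0 (hnum 3) t2) (hP.add (zmul ht hZ))).mul hQ
  have h2 : (6 * (Q' * P - Q * P')).IsHomogeneous 2 :=
    zmul (hnum 6) ((hQ'.mul hP).sub (hQ.mul hP'))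
  have h3 : (6 * (t - 2) * Q * P).IsHomogeneous 2 :=
    (zmul (zmul0 (hnum 6) t2) hQ).mul hP
  have h4 : (3 * (t - 2) * t * (t - 6) * Q ^ 2).IsHomogeneous 2 :=
    zmul (zmul0 (zmul0 (zmul0 (hnum 3) t2) ht) (ht.sub (hnum 6))) (hQ.pow 2)
  have h0 : (Z * P).IsHomogeneous 2 := hZ.mul hP
  exact (((h0.sub h1).add h2).sub h3).add h4

theorem iX_hom (ha : a.IsHomogeneous 0) (hb : b.IsHomogeneous 0) (hc : c.IsHomogeneous 0)
    (hi : i12.IsHomogeneous 0) :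
    (iX a b c i12 (X : Fin 5 → MvPolynomial (Fin 5) ℝ)).IsHomogeneous 1 := by
  have hX : ∀ i, (X i : MvPolynomial (Fin 5) ℝ).IsHomogeneous 1 := fun i => isHomogeneous_X _ i
  exact zmul (zmul0 hi ha) ((zmul hc ((hX 4).sub (hX 0))).sub
    (zmul (zmul0 (hnum 2) hb) ((hX 2).sub (hX 0))))

theorem iD_hom (hc : c.IsHomogeneous 0) (hi : i12.IsHomogeneous 0) :
    (iD c i12 (X : Fin 5 → MvPolynomial (Fin 5) ℝ)).IsHomogeneous 1 := by
  have hX : ∀ i, (X i : MvPolynomial (Fin 5) ℝ).IsHomogeneous 1 := fun i => isHomogeneous_X _ i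
  exact zmul (zmul0 hi hc) ((hX 3).sub (hX 1))

theorem iS_hom (hk : k.IsHomogeneous 0) (ha : a.IsHomogeneous 0) (hb : b.IsHomogeneous 0)
    (hc : c.IsHomogeneous 0) (hi : i12.IsHomogeneous 0) :
    (iS k a b c i12 (X : Fin 5 → MvPolynomial (Fin 5) ℝ)).IsHomogeneous 1 := by
  have hX : ∀ i, (X i : MvPolynomial (Fin 5) ℝ).IsHomogeneous 1 := fun i => isHomogeneous_X _ i
  exact (zmul hc ((hX 4).sub (hX 0))).sub (zmul (zmul0 (hnum 3)
    ((zmul0 hk (hk.add hone)).add (hnum 6))) (iX_hom ha hb hc hi))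

theorem iY_hom (hk : k.IsHomogeneous 0) (hc : c.IsHomogeneous 0) (hi : i12.IsHomogeneous 0) :
    (iY k c i12 (X : Fin 5 → MvPolynomial (Fin 5) ℝ)).IsHomogeneous 1 := by
  exact (isHomogeneous_X _ 1).sub (zmul (zmul0 (zmul0 (hnum 3) (hk.sub hone))
    (hk.sub (hnum 2))) (iD_hom hc hi))

theorem iZ_hom (hk : k.IsHomogeneous 0) (hhf : hf.IsHomogeneous 0) (ha : a.IsHomogeneous 0)
    (hb : b.IsHomogeneous 0) (hc : c.IsHomogeneous 0) (hi : i12.IsHomogeneous 0)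
    (hs : s.IsHomogeneous 0) :
    (iZ k hf a b c i12 s (X : Fin 5 → MvPolynomial (Fin 5) ℝ)).IsHomogeneous 1 :=
  zmul hhf ((iS_hom hk ha hb hc hi).add (zmul hs (iY_hom hk hc hi)))

theorem iQ_hom (hhf : hf.IsHomogeneous 0) (ha : a.IsHomogeneous 0)
    (hb : b.IsHomogeneous 0) (hc : c.IsHomogeneous 0) (hi : i12.IsHomogeneous 0)
    (hs : s.IsHomogeneous 0) :
    (iQ hf a b c i12 s (X : Fin 5 → MvPolynomial (Fin 5) ℝ)).IsHomogeneous 1 :=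
  zmul hhf ((iX_hom ha hb hc hi).add (zmul hs (iD_hom hc hi)))

theorem iP_hom (hk : k.IsHomogeneous 0) (hhf : hf.IsHomogeneous 0) (ha : a.IsHomogeneous 0)
    (hb : b.IsHomogeneous 0) (hc : c.IsHomogeneous 0) (hi : i12.IsHomogeneous 0)
    (hs : s.IsHomogeneous 0) :
    (iP k hf a b c i12 s (X : Fin 5 → MvPolynomial (Fin 5) ℝ)).IsHomogeneous 1 :=
  (((isHomogeneous_X _ 0).sub (zmul (zmul0 hhf (zmul0 hk (hk.sub hone)))
    (iS_hom hk ha hb hc hi))).add (zmul (zmul0 (zmul0 (zmul0 (hnum 3) hk) (hk.sub hone))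
    (hk.sub (hnum 2))) (iX_hom ha hb hc hi))).sub
    (zmul (zmul0 hs (zmul0 hhf (zmul0 hk (hk.add hone)))) (iY_hom hk hc hi))

theorem inv_hom (hk : k.IsHomogeneous 0) (hhf : hf.IsHomogeneous 0) (ha : a.IsHomogeneous 0)
    (hb : b.IsHomogeneous 0) (hc : c.IsHomogeneous 0) (hi : i12.IsHomogeneous 0) (i : Fin 5) :
    (inv k hf a b c i12 (X : Fin 5 → MvPolynomial (Fin 5) ℝ) i).IsHomogeneous 4 := by
  have ht : (k * (k + 1)).IsHomogeneous 0 := zmul0 hk (hk.add hone)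
  have hm : (-1 : MvPolynomial (Fin 5) ℝ).IsHomogeneous 0 := hone.neg
  have P1 := iP_hom hk hhf ha hb hc hi hone
  have P2 := iP_hom hk hhf ha hb hc hi hm
  have Z1 := iZ_hom hk hhf ha hb hc hi hone
  have Z2 := iZ_hom hk hhf ha hb hc hi hm
  have Q1 := iQ_hom hhf ha hb hc hi hone
  have Q2 := iQ_hom hhf ha hb hc hi hm
  unfold inv
  fin_cases i
  · exact (P2.pow 2).mul (BB_hom ht P1 P2 Z1 Q1 Q2)
  · exact (Q1.mul P1).mul (P2.pow 2)
  · exact (P1.pow 2).mul (BB_hom ht P2 P1 Z2 Q2 Q1)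
  · exact (Q2.mul P2).mul (P1.pow 2)
  · exact (P1.pow 2).mul (P2.pow 2)

theorem nu_hom (hk : k.IsHomogeneous 0) (hhf : hf.IsHomogeneous 0) (ha : a.IsHomogeneous 0)
    (hb : b.IsHomogeneous 0) (hc : c.IsHomogeneous 0) (hi : i12.IsHomogeneous 0) :
    (nu k hf a b c i12 (X : Fin 5 → MvPolynomial (Fin 5) ℝ)).IsHomogeneous 15 := by
  have ht : (k * (k + 1)).IsHomogeneous 0 := zmul0 hk (hk.add hone)
  have hm : (-1 : MvPolynomial (Fin 5) ℝ).IsHomogeneous 0 := hone.neg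
  have P1 := iP_hom hk hhf ha hb hc hi hone
  have P2 := iP_hom hk hhf ha hb hc hi hm
  have Z1 := iZ_hom hk hhf ha hb hc hi hone
  have Q1 := iQ_hom hhf ha hb hc hi hone
  have Q2 := iQ_hom hhf ha hb hc hi hm
  have E1 := ee_hom ht Q1 P1
  have E2 := ee_hom ht Q2 P2
  refine ((P1.pow 6).mul (P2.pow 6)).mul (n := 3) ?_
  exact IsHomogeneous.add (((P1.add (zmul ht Z1)).mul E1).mul E2)
    ((zmul (zmul0 (hnum 6) ht) ((Q2.mul P1).sub (Q1.mul P2))).mul (E2.sub E1))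

end homogeneity

/-! ### Compatibility with ring homomorphisms -/

section maps
variable {R S : Type*} [CommRing R] [CommRing S] (f : R →+* S)

theorem map_fwd (k hf : R) (x : Fin 5 → R) (i : Fin 5) :
    f (fwd k hf x i) = fwd (f k) (f hf) (fun i => f (x i)) i := by
  fin_cases i <;> simp [map_ofNat f, fwd, lin, TT, ZZ, uu, ee, phi]

theorem map_inv (k hf a b c i12 : R) (x : Fin 5 → R) (i : Fin 5) :
    f (inv k hf a b c i12 x i)
      = inv (f k) (f hf) (f a) (f b) (f c) (f i12) (fun i => f (x i)) i := by
  fin_cases i <;> simp [map_ofNat f, inv, bwd, BB, iP, iQ, iZ, iS, iY, iX, iD]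

theorem map_mu (k : R) (x : Fin 5 → R) :
    f (mu k x) = mu (f k) (fun i => f (x i)) := by
  simp [map_ofNat f, mu, TT, uu, ee, phi]

theorem map_nu (k hf a b c i12 : R) (x : Fin 5 → R) :
    f (nu k hf a b c i12 x)
      = nu (f k) (f hf) (f a) (f b) (f c) (f i12) (fun i => f (x i)) := by
  simp [map_ofNat f, nu, NN, ee, iP, iQ, iZ, iS, iY, iX, iD]

end maps

theorem dehom_fwd (k : ℝ) (i : Fin 5) :
    aeval (![X 0, X 1, X 2, X 3, 1] : Fin 5 → MvPolynomial (Fin 4) ℝ)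
      (fwd (C k) (C (1/2)) (X : Fin 5 → MvPolynomial (Fin 5) ℝ) i) = g k i := by
  apply MvPolynomial.funext
  intro x
  rw [← AlgHom.coe_toRingHom, map_fwd, map_fwd]
  fin_cases i
  · simp [fwd, lin, TT, ZZ, uu, ee, phi, g, Hp, H₀]
    ring
  · simp [fwd, lin, TT, ZZ, uu, ee, phi, g, Kp, Lp, K₀]
    ring
  · simp [fwd, lin, TT, ZZ, uu, ee, phi, g, Jp, J₀, J₁]
    ring
  · simp [fwd, lin, TT, ZZ, uu, ee, phi, g, Kp, Lp, K₀]
    ring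
  · simp [fwd, lin, TT, ZZ, uu, ee, phi, g, Hp, H₀]
    ring

theorem gstar_eq (k : ℝ) (i : Fin 5) :
    gstar k i = fwd (C k) (C (1/2)) (X : Fin 5 → MvPolynomial (Fin 5) ℝ) i := by
  rw [gstar, ← dehom_fwd, homog_dehom _ (fwd_hom (isHomogeneous_C _ _) (isHomogeneous_C _ _) i)]

theorem eval_gstar (k : ℝ) (x : Fin 5 → ℝ) (i : Fin 5) :
    eval x (gstar k i) = fwd k (1/2) x i := by
  rw [gstar_eq, map_fwd]
  simp

end Krall

open MvPolynomial in
/-- For `k ∉ {−3/2, −1/2, 1/2}` the map `g*(k)` is birational of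
bidegree `(4, 4)`. -/
theorem gstar_birational_bidegree_four_four (k : ℝ)
    (hk : k ∉ ({-3/2, -1/2, 1/2} : Set ℝ)) :
    ∃ G : Fin 5 → MvPolynomial (Fin 5) ℝ,
      (∀ i, (G i).IsHomogeneous 4) ∧
      (∃ μ : MvPolynomial (Fin 5) ℝ, μ ≠ 0 ∧ μ.IsHomogeneous 15 ∧
        ∀ i : Fin 5, aeval (gstar k) (G i) = μ * X i) ∧
      (∃ ν : MvPolynomial (Fin 5) ℝ, ν ≠ 0 ∧ ν.IsHomogeneous 15 ∧
        ∀ i : Fin 5, aeval G (gstar k i) = ν * X i) := by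
  have hk1 : k ≠ -3/2 := fun h => hk (by simp [h])
  have hk2 : k ≠ -1/2 := fun h => hk (by simp [h])
  have hk3 : k ≠ 1/2 := fun h => hk (by simp [h])
  have ha : (2 * k - 1)⁻¹ * (2 * k - 1) = 1 :=
    inv_mul_cancel₀ (fun h => hk3 (by linarith))
  have hb : (2 * k + 3)⁻¹ * (2 * k + 3) = 1 :=
    inv_mul_cancel₀ (fun h => hk1 (by linarith))
  have hc : (2 * k + 1)⁻¹ * (2 * k + 1) = 1 :=
    inv_mul_cancel₀ (fun h => hk2 (by linarith))
  generalize (2 * k - 1)⁻¹ = a at ha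
  generalize (2 * k + 3)⁻¹ = b at hb
  generalize (2 * k + 1)⁻¹ = c at hc
  have hC : ∀ r : ℝ, (C r : MvPolynomial (Fin 5) ℝ).IsHomogeneous 0 :=
    fun r => isHomogeneous_C _ r
  have evG : ∀ (x : Fin 5 → ℝ) (i : Fin 5),
      eval x (Krall.inv (C k) (C (1/2)) (C a) (C b) (C c) (C (1/12)) X i)
        = Krall.inv k (1/2) a b c (1/12) x i := by
    intro x i
    rw [Krall.map_inv]
    simp
  have evA : ∀ (x : Fin 5 → ℝ) (F : Fin 5 → MvPolynomial (Fin 5) ℝ) (p : MvPolynomial (Fin 5) ℝ),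
      eval x (aeval F p) = eval (fun i => eval x (F i)) p := by
    intro x F p
    induction p using MvPolynomial.induction_on with
    | C r => simp
    | add p q hp hq => rw [map_add, map_add, map_add, hp, hq]
    | mul_X p i hp => rw [map_mul, map_mul, map_mul, hp, aeval_X, eval_X]
  refine ⟨Krall.inv (C k) (C (1/2)) (C a) (C b) (C c) (C (1/12)) X, fun i =>
    Krall.inv_hom (hC _) (hC _) (hC _) (hC _) (hC _) (hC _) i,
    ⟨Krall.mu (C k) X, ?_, Krall.mu_hom (hC _), fun i => ?_⟩,
    ⟨Krall.nu (C k) (C (1/2)) (C a) (C b) (C c) (C (1/12)) X, ?_,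
      Krall.nu_hom (hC _) (hC _) (hC _) (hC _) (hC _) (hC _), fun i => ?_⟩⟩
  · intro h
    have := congrArg (eval (![0, 0, 0, 0, 1] : Fin 5 → ℝ)) h
    rw [Krall.map_mu] at this
    simp [Krall.mu, Krall.TT, Krall.uu, Krall.ee, Krall.phi] at this
  · apply MvPolynomial.funext
    intro x
    rw [evA, evG, map_mul, Krall.map_mu]
    simp only [Krall.eval_gstar, eval_C, eval_X]
    exact Krall.inv_fwd k a b c x ha hb hc i
  · intro h
    have := congrArg (eval (![1, 0, 1, 0, 1] : Fin 5 → ℝ)) h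
    rw [Krall.map_nu] at this
    simp [Krall.nu, Krall.NN, Krall.ee, Krall.iP, Krall.iQ, Krall.iZ, Krall.iS, Krall.iY,
      Krall.iX, Krall.iD] at this
  · apply MvPolynomial.funext
    intro x
    rw [evA, Krall.eval_gstar, map_mul, Krall.map_nu]
    simp only [evG, eval_C, eval_X]
    exact Krall.fwd_inv k a b c x ha hb hc i
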